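/- arXiv:1505.02500 — 2 statements merged into one kernel-verified Lean document; each statement's English description precedes it below -/
import Mathlib

section
/- Assuming the continuum is less than ℵ_ω, for every k ≥ 2 there is a finite colouring of ℝ such that no infinite set X ⊆ ℝ has FS_k(X) ∪ {k·x : x ∈ X} monochromatic; in particular no infinite X ⊆ ℝ has kX = {x₁ + ... + x_k : x_i ∈ X} monochromatic. -/
open Cardinal

/-- Sums of `k` distinct elements of `X`. -/
def FS (k : ℕ) (X : Set ℝ) : Set ℝ :=
  {y | ∃ F : Finset ℝ, ↑F ⊆ X ∧ F.card = k ∧ y = ∑ x ∈ F, x}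

/-- `kX`: sums of `k` elements of `X`, repetitions allowed. -/
def kTimes (k : ℕ) (X : Set ℝ) : Set ℝ :=
  {y | ∃ f : Fin k → ℝ, (∀ i, f i ∈ X) ∧ y = ∑ i, f i}

/-- All sums of `k` distinct elements of `X` and all multiples `k • x`, `x ∈ X`, get one colour. -/
def MonoSums {V C : Type*} [AddCommMonoid V] (k : ℕ) (c : V → C) (X : Set V) : Prop :=
  ∃ i, (∀ F : Finset V, ↑F ⊆ X → F.card = k → c (∑ x ∈ F, x) = i) ∧ ∀ x ∈ X, c (k • x) = i

/-- Some finite colouring of `V` admits no infinite `X` with `MonoSums k c X`. -/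
def Avoidable (k : ℕ) (V : Type*) [AddCommMonoid V] : Prop :=
  ∃ (C : Type) (_ : Finite C) (c : V → C), ∀ X : Set V, X.Infinite → ¬ MonoSums k c X

section MonoSums

variable {V W C D : Type*} [AddCommMonoid V] [AddCommMonoid W] {k : ℕ}

theorem MonoSums.subset {c : V → C} {X Y : Set V} (h : MonoSums k c X) (hY : Y ⊆ X) :
    MonoSums k c Y := by
  obtain ⟨i, h₁, h₂⟩ := h
  exact ⟨i, fun F hF => h₁ F (hF.trans hY), fun x hx => h₂ x (hY hx)⟩

theorem MonoSums.color_sum_add {c : V → C} {X : Set V} (h : MonoSums k c X) {F : Finset V}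
    (hF : ↑F ⊆ X) (hk : F.card + 1 = k) {x : V} (hx : x ∈ X) (hxF : x ∉ F) :
    c (x + ∑ y ∈ F, y) = c (k • x) := by
  classical
  obtain ⟨i, h₁, h₂⟩ := h
  rw [h₂ x hx, ← Finset.sum_insert (f := fun y => y) hxF]
  refine h₁ _ ?_ (by rw [Finset.card_insert_of_notMem hxF, hk])
  rw [Finset.coe_insert]
  exact Set.insert_subset hx hF

theorem MonoSums.map_color {c : V → C} {c' : V → D} {X : Set V} (h : MonoSums k c X) (g : C → D)
    (h₁ : ∀ F : Finset V, ↑F ⊆ X → F.card = k → c' (∑ x ∈ F, x) = g (c (∑ x ∈ F, x)))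
    (h₂ : ∀ x ∈ X, c' (k • x) = g (c (k • x))) : MonoSums k c' X := by
  obtain ⟨i, hF, hx⟩ := h
  exact ⟨g i, fun F h h' => by rw [h₁ F h h', hF F h h'], fun x h => by rw [h₂ x h, hx x h]⟩

theorem MonoSums.image {c : W → C} {X : Set V} {f : V →+ W} (hf : Set.InjOn f X)
    (h : MonoSums k (c ∘ f) X) : MonoSums k c (f '' X) := by
  classical
  obtain ⟨i, h₁, h₂⟩ := h
  refine ⟨i, fun F hF hk => ?_, ?_⟩
  · obtain ⟨F', hF', rfl⟩ := Finset.subset_set_image_iff.1 hF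
    have hinj : Set.InjOn f F' := hf.mono hF'
    rw [Finset.card_image_of_injOn hinj] at hk
    rw [Finset.sum_image hinj, ← map_sum]
    exact h₁ F' hF' hk
  · rintro _ ⟨x, hx, rfl⟩
    rw [← map_nsmul]
    exact h₂ x hx

theorem Avoidable.of_injective (h : Avoidable k W) (f : V →+ W) (hf : Function.Injective f) :
    Avoidable k V := by
  obtain ⟨C, hC, c, hc⟩ := h
  exact ⟨C, hC, c ∘ f, fun X hX hm =>
    hc _ (hX.image hf.injOn) (hm.image hf.injOn)⟩

end MonoSums

/-- The graph of a function is finitely colourable away from its fixed points. -/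
theorem exists_coloring_ne_apply {α : Type*} (f : α → α) :
    ∃ c : α → ZMod 2 × Fin 3, ∀ x, f x ≠ x → c (f x) ≠ c x := by
  classical
  let r : Setoid α :=
    { r := fun x y => ∃ a b, f^[a] x = f^[b] y
      iseqv :=
        { refl := fun x => ⟨0, 0, rfl⟩
          symm := fun ⟨a, b, h⟩ => ⟨b, a, h.symm⟩
          trans := by
            rintro x y z ⟨a, b, h⟩ ⟨a', b', h'⟩
            refine ⟨a' + a, b + b', ?_⟩
            rw [Function.iterate_add_apply, h, ← Function.iterate_add_apply, Nat.add_comm a' b,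
              Function.iterate_add_apply, h', ← Function.iterate_add_apply] } }
  let root : α → α := fun x => (Quotient.mk r x).out
  have hroot : ∀ x, ∃ a b, f^[a] x = f^[b] (root x) := fun x =>
    r.iseqv.symm (Quotient.mk_out x)
  have hrootf : ∀ x, root (f x) = root x := fun x => by
    have : Quotient.mk r (f x) = Quotient.mk r x := Quotient.sound ⟨0, 1, rfl⟩
    simp only [root, this]
  let A : α → ℕ := fun x => Nat.find (hroot x)
  have hA : ∀ x, ∃ b, f^[A x] x = f^[b] (root x) := fun x => Nat.find_spec (hroot x)
  let B : α → ℕ := fun x => Nat.find (hA x)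
  have hB : ∀ x, f^[A x] x = f^[B x] (root x) := fun x => Nat.find_spec (hA x)
  have hA_le : ∀ x a b, f^[a] x = f^[b] (root x) → A x ≤ a := fun x a b h =>
    Nat.find_min' (hroot x) ⟨b, h⟩
  have hB_le : ∀ x b, f^[A x] x = f^[b] (root x) → B x ≤ b := fun x b h =>
    Nat.find_min' (hA x) h
  let last : α → Prop := fun x => B (f x) ≤ B x
  refine ⟨fun x => ((A x : ℕ), if last x then 2 else if Even (B x) then 0 else 1), fun x hx h => ?_⟩
  simp only [Prod.mk.injEq] at h
  obtain ⟨h₁, h₂⟩ := h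
  rcases Nat.eq_zero_or_pos (A x) with h0 | h0
  · have hx0 := hB x
    rw [h0, Function.iterate_zero, id] at hx0
    have hfx : f^[0] (f x) = f^[B x + 1] (root (f x)) := by
      rw [hrootf, Function.iterate_succ_apply', ← hx0]; rfl
    have hA0 : A (f x) = 0 := Nat.le_zero.1 (hA_le _ _ _ hfx)
    have hle : B (f x) ≤ B x + 1 := hB_le _ _ (by rw [hA0]; exact hfx)
    have hfx0 := hB (f x)
    rw [hA0, Function.iterate_zero, id, hrootf] at hfx0
    have hne : B (f x) ≠ B x := fun he => hx (by rw [hfx0, he, ← hx0])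
    by_cases hl : last x
    · have hl' : last (f x) := by
        by_contra hl'
        rw [if_pos hl, if_neg hl'] at h₂
        split_ifs at h₂ <;> simp at h₂
      have hlt : B (f x) < B x := lt_of_le_of_ne hl hne
      have hffx : A (f (f x)) = 0 := by
        refine Nat.le_zero.1 (hA_le _ 0 (B (f x) + 1) ?_)
        rw [hrootf, hrootf, Function.iterate_succ_apply', ← hfx0]; rfl
      have hffx0 := hB (f (f x))
      rw [hffx, Function.iterate_zero, id, hrootf, hrootf] at hffx0
      have hcyc : x = f^[(B x - (B (f x) + 1)) + B (f (f x))] (root x) := by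
        have hffx1 : f (f x) = f^[B (f x) + 1] (root x) := by
          rw [Function.iterate_succ_apply', ← hfx0]
        rw [Function.iterate_add_apply, ← hffx0, hffx1, ← Function.iterate_add_apply,
          Nat.sub_add_cancel hlt, ← hx0]
      have := hB_le x _ (by rw [h0]; exact hcyc)
      have : B (f (f x)) ≤ B (f x) := hl'
      omega
    · have hBx : B (f x) = B x + 1 := by
        have : ¬ B (f x) ≤ B x := hl
        omega
      have hpar : Even (B (f x)) ↔ ¬ Even (B x) := by rw [hBx, Nat.even_add_one]
      rw [if_neg hl] at h₂
      by_cases he : Even (B x) <;> simp only [he, hpar, not_true_eq_false, not_false_eq_true,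
        if_true, if_false] at h₂ <;> split_ifs at h₂ <;> simp at h₂
  · have hAx : A (f x) + 1 = A x := by
      apply le_antisymm
      · have : A (f x) ≤ A x - 1 := by
          refine hA_le _ _ (B x) ?_
          rw [← Function.iterate_succ_apply, Nat.succ_eq_add_one, Nat.sub_add_cancel h0, hrootf]
          exact hB x
        omega
      · refine hA_le _ _ (B (f x)) ?_
        rw [Function.iterate_succ_apply, hB (f x), hrootf]
    rw [← hAx] at h₁
    simp at h₁

/-- A set mapping to a well-order contains an infinite subset on which the map is constant, or one
on which every value is exceeded off a finite set. -/
theorem Set.Infinite.exists_constant_or_finite_le {V ι : Type*} [LinearOrder ι] [WellFoundedLT ι]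
    {X : Set V} (hX : X.Infinite) (t : V → ι) :
    ∃ Y ⊆ X, Y.Infinite ∧
      ((∃ a, ∀ x ∈ Y, t x = a) ∨ ∀ y ∈ Y, {x ∈ Y | t x ≤ t y}.Finite) := by
  by_cases h : ∃ b, {x ∈ X | t x ≤ b}.Infinite
  · obtain ⟨b, hb, hmin⟩ := WellFounded.has_min (wellFounded_lt (α := ι))
      {b | {x ∈ X | t x ≤ b}.Infinite} h
    by_cases hfib : {x ∈ X | t x = b}.Infinite
    · exact ⟨_, fun x hx => hx.1, hfib, Or.inl ⟨b, fun x hx => hx.2⟩⟩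
    · refine ⟨{x ∈ X | t x < b}, fun x hx => hx.1, fun hfin => hb ?_, Or.inr fun y hy => ?_⟩
      · refine (hfin.union (Set.not_infinite.1 hfib)).subset fun x hx => ?_
        rcases hx.2.lt_or_eq with h | h
        · exact Or.inl ⟨hx.1, h⟩
        · exact Or.inr ⟨hx.1, h⟩
      · by_contra hinf
        exact hmin (t y) (Set.Infinite.mono (fun x hx => ⟨hx.1.1, hx.2⟩) hinf) hy.2
  · push Not at h
    exact ⟨X, subset_rfl, hX, Or.inr fun y _ => h (t y)⟩

/-- `a` is the largest element of the support of `x`. -/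
def IsLeading {ι : Type*} [LT ι] (x : ι →₀ ℚ) (a : ι) : Prop :=
  x a ≠ 0 ∧ ∀ b, a < b → x b = 0

section IsLeading

variable {ι : Type*} [LinearOrder ι]

theorem exists_isLeading {x : ι →₀ ℚ} (hx : x ≠ 0) : ∃ a, IsLeading x a := by
  have h := Finsupp.support_nonempty_iff.2 hx
  refine ⟨x.support.max' h, Finsupp.mem_support_iff.1 (Finset.max'_mem _ h), fun b hb => ?_⟩
  by_contra hne
  exact hb.not_ge (Finset.le_max' _ _ (Finsupp.mem_support_iff.2 hne))

theorem IsLeading.ne_zero {x : ι →₀ ℚ} {a : ι} (h : IsLeading x a) : x ≠ 0 := by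
  rintro rfl
  exact h.1 rfl

theorem IsLeading.unique {x : ι →₀ ℚ} {a b : ι} (ha : IsLeading x a) (hb : IsLeading x b) : a = b := by
  rcases lt_trichotomy a b with h | h | h
  · exact absurd (ha.2 b h) hb.1
  · exact h
  · exact absurd (hb.2 a h) ha.1

theorem IsLeading.nsmul {x : ι →₀ ℚ} {a : ι} (h : IsLeading x a) {k : ℕ} (hk : k ≠ 0) :
    IsLeading (k • x) a :=
  ⟨by simp [hk, h.1], fun b hb => by simp [h.2 b hb]⟩

theorem IsLeading.add {x y : ι →₀ ℚ} {a : ι} (h : IsLeading x a) (hy : ∀ b, a ≤ b → y b = 0) :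
    IsLeading (x + y) a :=
  ⟨by simp [h.1, hy a le_rfl], fun b hb => by simp [h.2 b hb, hy b hb.le]⟩

end IsLeading

theorem Avoidable.finsupp_of_initialSegments {k : ℕ} (hk : 2 ≤ k) {ι κ : Type} [LinearOrder ι]
    [WellFoundedLT ι] [Nonempty ι] (e : ∀ a : ι, Set.Iic a → κ)
    (he : ∀ a, Function.Injective (e a)) (h : Avoidable k (κ →₀ ℚ)) : Avoidable k (ι →₀ ℚ) := by
  classical
  obtain ⟨C, hC, c, hc⟩ := h
  obtain ⟨L, hL⟩ := exists_coloring_ne_apply fun q : ℚ => k • q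
  have hLk : ∀ q : ℚ, q ≠ 0 → L (k • q) ≠ L q := fun q hq => hL q fun h => by
    have h' : (k : ℚ) * q = q := by simpa using h
    have : (k : ℚ) = 1 := by simpa [hq] using h'
    have : k = 1 := by exact_mod_cast this
    omega
  have htop : ∀ x : ι →₀ ℚ, ∃ a, x ≠ 0 → IsLeading x a := fun x => by
    by_cases hx : x = 0
    · exact ⟨Classical.arbitrary ι, fun h => absurd hx h⟩
    · obtain ⟨a, ha⟩ := exists_isLeading hx
      exact ⟨a, fun _ => ha⟩
  choose t ht using htop
  have ht_eq : ∀ {x a}, IsLeading x a → t x = a := fun h => (ht _ h.ne_zero).unique h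
  let f : ι → (ι →₀ ℚ) →+ (κ →₀ ℚ) := fun a =>
    (Finsupp.mapDomain.addMonoidHom (e a)).comp Finsupp.subtypeDomainAddMonoidHom
  refine ⟨(ZMod 2 × Fin 3) × C, inferInstance, fun x => (L (x (t x)), c (f (t x) x)),
    fun X hX hm => ?_⟩
  have hX0 : (X \ {0}).Infinite := hX.sdiff (Set.finite_singleton 0)
  obtain ⟨Y, hYX, hY, hconst | hfin⟩ := hX0.exists_constant_or_finite_le t
  · obtain ⟨a, ha⟩ := hconst
    have hYt : ∀ x ∈ Y, IsLeading x a := fun x hx => ha x hx ▸ ht x (hYX hx).2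
    obtain ⟨Z, hZY, hZ, hsum⟩ : ∃ Z ⊆ Y, Z.Infinite ∧
        ∀ F : Finset (ι →₀ ℚ), ↑F ⊆ Z → F.card = k → (∑ x ∈ F, x) a ≠ 0 := by
      have hYu : Y = {x ∈ Y | 0 < x a} ∪ {x ∈ Y | x a < 0} := by
        ext x
        refine ⟨fun hx => ?_, fun hx => hx.elim And.left And.left⟩
        rcases lt_or_gt_of_ne (hYt x hx).1 with h | h
        · exact Or.inr ⟨hx, h⟩
        · exact Or.inl ⟨hx, h⟩
      rw [hYu, Set.infinite_union] at hY
      have hne : ∀ F : Finset (ι →₀ ℚ), F.card = k → F.Nonempty := fun F hF =>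
        Finset.card_pos.1 (by omega)
      rcases hY with hY | hY
      · refine ⟨_, fun x hx => hx.1, hY, fun F hF hk => ?_⟩
        rw [Finsupp.finsetSum_apply]
        exact (Finset.sum_pos (fun x hx => (hF hx).2) (hne F hk)).ne'
      · refine ⟨_, fun x hx => hx.1, hY, fun F hF hk => ?_⟩
        rw [Finsupp.finsetSum_apply]
        exact (Finset.sum_neg (fun x hx => (hF hx).2) (hne F hk)).ne
    have hinj : Set.InjOn (f a) Z := fun x hx y hy hxy => by
      have h' : Finsupp.subtypeDomain (Set.Iic a) x = Finsupp.subtypeDomain (Set.Iic a) y :=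
        Finsupp.mapDomain_injective (he a) hxy
      ext b
      rcases le_or_gt b a with hb | hb
      · exact DFunLike.congr_fun h' ⟨b, hb⟩
      · rw [(hYt x (hZY hx)).2 b hb, (hYt y (hZY hy)).2 b hb]
    refine hc _ (hZ.image hinj) (MonoSums.image hinj ?_)
    refine (hm.subset ((hZY.trans hYX).trans Set.sdiff_subset)).map_color Prod.snd
      (fun F hF hFk => ?_) (fun x hx => ?_)
    · have : IsLeading (∑ x ∈ F, x) a := ⟨hsum F hF hFk, fun b hb => by
        rw [Finsupp.finsetSum_apply]
        exact Finset.sum_eq_zero fun x hx => (hYt x (hZY (hF hx))).2 b hb⟩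
      simp only [ht_eq this, Function.comp_apply]
    · have := (hYt x (hZY hx)).nsmul (k := k) (by omega)
      simp only [ht_eq this, Function.comp_apply]
  · obtain ⟨F, hFY, hFk⟩ := hY.exists_subset_card_eq (k - 1)
    have hbad : (⋃ y ∈ F, {x ∈ Y | t x ≤ t y}).Finite :=
      F.finite_toSet.biUnion fun y hy => hfin y (hFY hy)
    obtain ⟨x, hxY, hx⟩ := (hY.sdiff hbad).nonempty
    simp only [Set.mem_iUnion, Set.mem_ofPred_eq, not_exists, not_and, not_le] at hx
    have hlt : ∀ y ∈ F, t y < t x := fun y hy => hx y hy hxY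
    have hcol := (hm.subset (hYX.trans Set.sdiff_subset)).color_sum_add hFY (by omega) hxY
      (fun hxF => (hlt x hxF).false)
    have hxt : IsLeading x (t x) := ht x (hYX hxY).2
    have hs : ∀ b, t x ≤ b → (∑ y ∈ F, y) b = 0 := fun b hb => by
      rw [Finsupp.finsetSum_apply]
      exact Finset.sum_eq_zero fun y hy =>
        (ht y (hYX (hFY hy)).2).2 b ((hlt y hy).trans_le hb)
    have h₁ := congrArg Prod.fst hcol
    simp only [ht_eq (hxt.add hs), ht_eq (hxt.nsmul (k := k) (by omega)), Finsupp.add_apply,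
      hs _ le_rfl, add_zero, Finsupp.smul_apply] at h₁
    exact hLk _ hxt.1 h₁.symm

/-- Logarithmic scales modulo `4` tell `t'` near `t` apart from `k * t`. -/
theorem floor_two_mul_logb_ne {k t t' : ℝ} (hk : 2 ≤ k) (ht : 0 < t) (ht' : 0 < t')
    (h₁ : t' ^ 2 ≤ 2 * t ^ 2) (h₂ : t ^ 2 ≤ 2 * t' ^ 2) :
    ((⌊2 * Real.logb k t'⌋ : ℤ) : ZMod 4) ≠ ((⌊2 * Real.logb k (k * t)⌋ : ℤ) : ZMod 4) := by
  have hk1 : 1 < k := by linarith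
  have key : ∀ {a b : ℝ}, 0 < a → 0 < b → a ^ 2 ≤ 2 * b ^ 2 →
      2 * Real.logb k a ≤ 1 + 2 * Real.logb k b := fun {a b} ha hb h => by
    have h' : a ^ 2 ≤ k * b ^ 2 := h.trans (by gcongr)
    have := Real.logb_le_logb_of_le hk1 (by positivity) h'
    rw [Real.logb_mul (by positivity) (by positivity), Real.logb_pow, Real.logb_pow,
      Real.logb_self_eq_one hk1] at this
    exact_mod_cast this
  have e₁ := key ht' ht h₁
  have e₂ := key ht ht' h₂
  have hmul : 2 * Real.logb k (k * t) = 2 * Real.logb k t + (2 : ℤ) := by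
    rw [Real.logb_mul (by positivity) ht.ne', Real.logb_self_eq_one hk1]
    push_cast
    ring
  rw [hmul, Int.floor_add_intCast]
  have f₁ : ⌊2 * Real.logb k t'⌋ ≤ ⌊2 * Real.logb k t⌋ + 1 := by
    rw [← Int.floor_add_one]
    exact Int.floor_le_floor (by linarith)
  have f₂ : ⌊2 * Real.logb k t⌋ ≤ ⌊2 * Real.logb k t'⌋ + 1 := by
    rw [← Int.floor_add_one]
    exact Int.floor_le_floor (by linarith)
  intro h
  have := (ZMod.intCast_eq_intCast_iff_dvd_sub _ _ 4).1 h
  push_cast at this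
  omega

theorem Avoidable.of_filtration {V : Type*} [AddCommGroup V] {k : ℕ} (hk : 2 ≤ k)
    (H : ℕ → AddSubgroup V) (hmono : Monotone H) (hcover : ∀ x, ∃ n, x ∈ H n)
    (hH : ∀ n x, k • x ∈ H n → x ∈ H (n + 1))
    (hH' : ∀ n x, (k - 1) • x ∈ H n → x ∈ H (n + 1))
    (N : V → ℝ) (hN_add : ∀ x y, N (x + y) ≤ N x + N y) (hN_neg : ∀ x, N (-x) = N x)
    (hN_nsmul : ∀ x, N (k • x) = k * N x) (hN_fin : ∀ n B, {x ∈ H n | N x ≤ B}.Finite) :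
    Avoidable k V := by
  classical
  have hL : ∀ n, ∃ L : V ⧸ H n → ZMod 2 × Fin 3, ∀ x, k • x ≠ x → L (k • x) ≠ L x := fun n =>
    exists_coloring_ne_apply _
  choose L hL using hL
  let r : V → ℕ := fun x => Nat.find (hcover x)
  have hr_mem : ∀ x, x ∈ H (r x) := fun x => Nat.find_spec (hcover x)
  have hr_le : ∀ x n, x ∈ H n → r x ≤ n := fun x n h => Nat.find_min' (hcover x) h
  refine ⟨ZMod 2 × (ZMod 2 × Fin 3) × ZMod 4, inferInstance, fun x =>
    ((r x : ZMod 2), L (r x - 2) (QuotientAddGroup.mk x), (⌊2 * Real.logb k (N x)⌋ : ℤ)),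
    fun X hX hm => ?_⟩
  obtain ⟨F, hFX, hFk⟩ := hX.exists_subset_card_eq (k - 1)
  have hcol := fun x hx hxF => hm.color_sum_add hFX (by omega) (x := x) hx hxF
  simp only [Prod.mk.injEq] at hcol
  generalize hs : ∑ y ∈ F, y = s at hcol
  by_cases hb : ∃ n, X ⊆ H n
  · obtain ⟨n, hn⟩ := hb
    obtain ⟨x, ⟨hxX, hxF⟩, hx⟩ : ∃ x ∈ X \ ↑F, 4 * |N s| + 1 < N x := by
      by_contra! hcon
      exact (hX.sdiff F.finite_toSet)
        ((hN_fin n (4 * |N s| + 1)).subset fun x hx => ⟨hn hx.1, hcon x hx⟩)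
    have h₁ := hN_add x s
    have h₂ := hN_add (x + s) (-s)
    rw [add_neg_cancel_right, hN_neg] at h₂
    have := le_abs_self (N s)
    have := abs_nonneg (N s)
    have hne := floor_two_mul_logb_ne (k := k) (t := N x) (t' := N (x + s))
      (by exact_mod_cast hk) (by linarith) (by linarith) (by nlinarith) (by nlinarith)
    rw [← hN_nsmul] at hne
    exact hne (hcol x hxX hxF).2.2
  · push Not at hb
    obtain ⟨n, hn⟩ : ∃ n, ∀ y ∈ F, y ∈ H n :=
      ⟨F.sup r, fun y hy => hmono (Finset.le_sup hy) (hr_mem y)⟩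
    have hsn : s ∈ H n := hs ▸ sum_mem hn
    obtain ⟨x, hxX, hxn⟩ := Set.not_subset.1 (hb (n + 2))
    have hrx : n + 2 < r x := by
      by_contra! h
      exact hxn (hmono h (hr_mem x))
    obtain ⟨c₁, c₂, -⟩ := hcol x hxX fun h => hxn (hmono (by omega) (hn x h))
    have hrxs : r (x + s) = r x := by
      apply le_antisymm
      · exact hr_le _ _ (add_mem (hr_mem x) (hmono (by omega) hsn))
      · by_contra! h
        have := hr_le x (max (r (x + s)) n) <| by
          simpa using sub_mem (hmono (le_max_left _ n) (hr_mem (x + s)))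
            (hmono (le_max_right (r (x + s)) _) hsn)
        rcases le_max_iff.1 this with h | h <;> omega
    have hle : r (k • x) ≤ r x := hr_le _ _ (nsmul_mem (hr_mem x) k)
    have hge : r x ≤ r (k • x) + 1 := hr_le _ _ (hH _ _ (hr_mem _))
    have hrk : r (k • x) = r x := by
      rw [hrxs, ZMod.natCast_eq_natCast_iff'] at c₁
      omega
    rw [hrxs, hrk] at c₂
    have hq : (QuotientAddGroup.mk (x + s) : V ⧸ H (r x - 2)) = QuotientAddGroup.mk x := by
      rw [eq_comm, QuotientAddGroup.eq, neg_add_cancel_left]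
      exact hmono (by omega) hsn
    rw [hq, QuotientAddGroup.mk_nsmul] at c₂
    refine hL _ _ (fun h => ?_) c₂.symm
    rw [← QuotientAddGroup.mk_nsmul, eq_comm, QuotientAddGroup.eq] at h
    have hx : (k - 1) • x ∈ H (r x - 2) := by
      obtain ⟨j, rfl⟩ : ∃ j, k = j + 1 := ⟨k - 1, by omega⟩
      simpa [succ_nsmul] using h
    have := hr_le _ _ (hH' _ _ hx)
    omega

/-- Vectors supported on `[0, n)` with entries in `(1 / d) ℤ`. -/
def boundedLattice (d n : ℕ) : AddSubgroup (ℕ →₀ ℚ) where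
  carrier := {x | (∀ i, n ≤ i → x i = 0) ∧ ∀ i, ∃ z : ℤ, (d : ℚ) * x i = z}
  zero_mem' := ⟨fun _ _ => rfl, fun _ => ⟨0, by simp⟩⟩
  add_mem' := fun {x y} hx hy => ⟨fun i hi => by simp [hx.1 i hi, hy.1 i hi], fun i => by
    obtain ⟨a, ha⟩ := hx.2 i
    obtain ⟨b, hb⟩ := hy.2 i
    exact ⟨a + b, by simp [mul_add, ha, hb]⟩⟩
  neg_mem' := fun {x} hx => ⟨fun i hi => by simp [hx.1 i hi], fun i => by
    obtain ⟨a, ha⟩ := hx.2 i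
    exact ⟨-a, by simp [ha]⟩⟩

theorem boundedLattice_le {d d' n n' : ℕ} (hd : d ∣ d') (hn : n ≤ n') :
    boundedLattice d n ≤ boundedLattice d' n' := fun x hx => by
  obtain ⟨e, rfl⟩ := hd
  refine ⟨fun i hi => hx.1 i (hn.trans hi), fun i => ?_⟩
  obtain ⟨z, hz⟩ := hx.2 i
  exact ⟨e * z, by push_cast; rw [← hz]; ring⟩

theorem mem_boundedLattice_of_nsmul {d d' n n' m : ℕ} (hm : m ≠ 0) (hd : d * m ∣ d')
    (hn : n ≤ n') {x : ℕ →₀ ℚ} (hx : m • x ∈ boundedLattice d n) : x ∈ boundedLattice d' n' := by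
  refine boundedLattice_le hd hn ⟨fun i hi => ?_, fun i => ?_⟩
  · have := hx.1 i hi
    simpa [hm] using this
  · obtain ⟨z, hz⟩ := hx.2 i
    refine ⟨z, ?_⟩
    rw [← hz]
    simp [mul_assoc]

theorem exists_mem_boundedLattice (x : ℕ →₀ ℚ) {d : ℕ → ℕ} (hd : ∀ n, n.factorial ∣ d n) :
    ∃ n, x ∈ boundedLattice (d n) n := by
  refine ⟨∑ i ∈ x.support, (i + 1 + (x i).den), fun i hi => ?_, fun i => ?_⟩
  · by_contra hne
    have := Finset.single_le_sum (f := fun i => i + 1 + (x i).den) (fun _ _ => Nat.zero_le _)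
      (Finsupp.mem_support_iff.2 hne)
    omega
  · by_cases h0 : x i = 0
    · exact ⟨0, by simp [h0]⟩
    · have hle := Finset.single_le_sum (f := fun i => i + 1 + (x i).den) (fun _ _ => Nat.zero_le _)
        (Finsupp.mem_support_iff.2 h0)
      obtain ⟨e, he⟩ := (Nat.dvd_factorial (x i).den_pos (le_trans (by omega) hle)).trans (hd _)
      refine ⟨e * (x i).num, ?_⟩
      rw [he]
      push_cast
      rw [← Rat.mul_den_eq_num (x i)]
      ring

/-- The `ℓ¹` norm. -/
def l1Norm (x : ℕ →₀ ℚ) : ℚ := ∑ i ∈ x.support, |x i|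

theorem l1Norm_eq_sum {x : ℕ →₀ ℚ} {S : Finset ℕ} (h : x.support ⊆ S) :
    l1Norm x = ∑ i ∈ S, |x i| :=
  Finset.sum_subset h fun i _ hi => by simpa using hi

theorem l1Norm_add_le (x y : ℕ →₀ ℚ) : l1Norm (x + y) ≤ l1Norm x + l1Norm y := by
  classical
  rw [l1Norm_eq_sum Finsupp.support_add, l1Norm_eq_sum (x := x) Finset.subset_union_left,
    l1Norm_eq_sum (x := y) Finset.subset_union_right, ← Finset.sum_add_distrib]
  exact Finset.sum_le_sum fun i _ => abs_add_le _ _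

theorem l1Norm_neg (x : ℕ →₀ ℚ) : l1Norm (-x) = l1Norm x := by
  simp [l1Norm, Finsupp.support_neg]

theorem l1Norm_nsmul (k : ℕ) (x : ℕ →₀ ℚ) : l1Norm (k • x) = k * l1Norm x := by
  rw [l1Norm_eq_sum Finsupp.support_smul, l1Norm, Finset.mul_sum]
  exact Finset.sum_congr rfl fun i _ => by simp [abs_mul]

theorem abs_apply_le_l1Norm (x : ℕ →₀ ℚ) (i : ℕ) : |x i| ≤ l1Norm x := by
  classical
  rw [l1Norm_eq_sum (Finset.subset_insert i _)]
  exact Finset.single_le_sum (f := fun i => |x i|) (fun _ _ => abs_nonneg _)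
    (Finset.mem_insert_self i _)

theorem finite_boundedLattice_l1Norm_le {d : ℕ} (hd : d ≠ 0) (n : ℕ) (B : ℝ) :
    {x ∈ boundedLattice d n | (l1Norm x : ℝ) ≤ B}.Finite := by
  have hd' : (0 : ℚ) < d := by exact_mod_cast Nat.pos_of_ne_zero hd
  obtain ⟨M, hM⟩ := exists_nat_ge B
  have hS : {q : ℚ | (∃ z : ℤ, (d : ℚ) * q = z) ∧ |q| ≤ M}.Finite := by
    refine ((Set.finite_Icc (-(d * M : ℤ)) (d * M)).image fun z : ℤ => (z : ℚ) / d).subset ?_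
    rintro q ⟨⟨z, hz⟩, hq⟩
    refine ⟨z, ?_, by simp only [← hz]; field_simp⟩
    have : |(z : ℚ)| ≤ d * M := by
      rw [← hz, abs_mul, abs_of_pos hd']
      gcongr
    rw [Set.mem_Icc, ← abs_le]
    exact_mod_cast this
  refine Set.Finite.of_finite_image (f := fun (x : ℕ →₀ ℚ) (i : Fin n) => x i)
    ((Set.Finite.pi' fun _ : Fin n => hS).subset ?_) fun x hx y hy hxy => ?_
  · rintro _ ⟨x, hx, rfl⟩ i
    refine ⟨hx.1.2 i, (abs_apply_le_l1Norm x i).trans ?_⟩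
    exact_mod_cast hx.2.trans hM
  · ext i
    rcases lt_or_ge i n with hi | hi
    · exact congrFun hxy ⟨i, hi⟩
    · rw [hx.1.1 i hi, hy.1.1 i hi]

theorem avoidable_nat_finsupp {k : ℕ} (hk : 2 ≤ k) : Avoidable k (ℕ →₀ ℚ) := by
  let d : ℕ → ℕ := fun n => n.factorial * (k * (k - 1)) ^ n
  have hkk : k * (k - 1) ≠ 0 := by
    have : k - 1 ≠ 0 := by omega
    positivity
  have hd0 : ∀ n, d n ≠ 0 := fun n => mul_ne_zero n.factorial_ne_zero (pow_ne_zero _ hkk)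
  have hd_succ : ∀ n, d n * (k * (k - 1)) ∣ d (n + 1) := fun n =>
    ⟨n + 1, by simp only [d, Nat.factorial_succ, pow_succ]; ring⟩
  refine Avoidable.of_filtration hk (fun n => boundedLattice (d n) n)
    (monotone_nat_of_le_succ fun n => boundedLattice_le ((dvd_mul_right _ _).trans (hd_succ n))
      n.le_succ)
    (fun x => exists_mem_boundedLattice x fun n => dvd_mul_right _ _)
    (fun n x => mem_boundedLattice_of_nsmul (by omega)
      ((mul_dvd_mul_left _ (dvd_mul_right _ _)).trans (hd_succ n)) n.le_succ)
    (fun n x => mem_boundedLattice_of_nsmul (by omega)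
      ((mul_dvd_mul_left _ (dvd_mul_left _ _)).trans (hd_succ n)) n.le_succ)
    (fun x => (l1Norm x : ℝ)) (fun x y => by exact_mod_cast l1Norm_add_le x y)
    (fun x => by rw [l1Norm_neg]) (fun x => by rw [l1Norm_nsmul]; push_cast; rfl)
    (fun n B => finite_boundedLattice_l1Norm_le (hd0 n) n B)

theorem avoidable_finsupp_of_mk_le_aleph {k : ℕ} (hk : 2 ≤ k) (m : ℕ) :
    ∀ ι : Type, #ι ≤ aleph m → Avoidable k (ι →₀ ℚ) := by
  have of_embedding : ∀ {ι κ : Type}, #ι ≤ #κ → Avoidable k (κ →₀ ℚ) → Avoidable k (ι →₀ ℚ) :=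
    fun {ι κ} hle h => by
      obtain ⟨e⟩ := hle
      exact h.of_injective (Finsupp.mapDomain.addMonoidHom e) (Finsupp.mapDomain_injective e.2)
  induction m with
  | zero =>
    intro ι hι
    exact of_embedding (by simpa using hι) (avoidable_nat_finsupp hk)
  | succ m ih =>
    intro ι hι
    let κ : Type := (aleph (m + 1 : ℕ)).ord.ToType
    have hκ : #κ = aleph (m + 1 : ℕ) := mk_ord_toType _
    let μ : Type := (aleph m).out
    have hμ : #μ = aleph m := mk_out _
    have hne : Nonempty κ := mk_ne_zero_iff.1 (hκ ▸ (aleph_pos _).ne')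
    have hseg : ∀ a : κ, Nonempty (Set.Iic a ↪ μ) := fun a => by
      have hlt : #(Set.Iio a) ≤ aleph m := by
        rw [← Order.lt_succ_iff, succ_aleph, ← Nat.cast_succ]
        exact (mk_Iio_lt a (by rw [hκ, Ordinal.type_toType])).trans_eq hκ
      rw [← Cardinal.le_def, hμ, ← Set.Iio_insert]
      exact mk_insert_le.trans (add_le_of_le (aleph0_le_aleph _) hlt
        (one_le_aleph0.trans (aleph0_le_aleph _)))
    exact of_embedding (hι.trans hκ.ge) (Avoidable.finsupp_of_initialSegments hk
      (fun a => (hseg a).some) (fun a => (hseg a).some.2) (ih μ hμ.le))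

theorem avoidable_real (hc : Cardinal.continuum < aleph Ordinal.omega0) {k : ℕ} (hk : 2 ≤ k) :
    Avoidable k ℝ := by
  obtain ⟨o, ho⟩ := mem_range_aleph_iff.2 aleph0_le_continuum
  rw [← ho, aleph_lt_aleph, Ordinal.lt_omega0] at hc
  obtain ⟨m, rfl⟩ := hc
  rw [← lift_continuum.{_, 0}, aleph_natCast_eq_lift] at ho
  let b := Module.Basis.ofVectorSpace ℚ ℝ
  refine Avoidable.of_injective (avoidable_finsupp_of_mk_le_aleph hk m
    (Module.Basis.ofVectorSpaceIndex ℚ ℝ) ?_) b.repr.toLinearMap.toAddMonoidHom b.repr.injective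
  rw [ho, ← mk_real]
  exact mk_set_le _

theorem stmt_8 (hc : Cardinal.continuum < aleph Ordinal.omega0) (k : ℕ) (hk : 2 ≤ k) :
    ∃ (n : ℕ) (c : ℝ → Fin n),
      (¬ ∃ X : Set ℝ, X.Infinite ∧
        ∃ i, ∀ y ∈ FS k X ∪ (fun x => k • x) '' X, c y = i) ∧
      (¬ ∃ X : Set ℝ, X.Infinite ∧ ∃ i, ∀ y ∈ kTimes k X, c y = i) := by
  obtain ⟨C, hC, c, hc⟩ := avoidable_real hc hk
  obtain ⟨n, ⟨e⟩⟩ := Finite.exists_equiv_fin C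
  have main : ∀ X : Set ℝ, X.Infinite →
      ¬ ∃ i, ∀ y ∈ FS k X ∪ (fun x => k • x) '' X, e (c y) = i := by
    rintro X hX ⟨i, hi⟩
    refine hc X hX ⟨e.symm i, fun F hF hFk => ?_, fun x hx => ?_⟩
    · rw [← hi _ (Or.inl ⟨F, hF, hFk, rfl⟩), Equiv.symm_apply_apply]
    · rw [← hi _ (Or.inr ⟨x, hx, rfl⟩), Equiv.symm_apply_apply]
  refine ⟨n, fun x => e (c x), fun ⟨X, hX, h⟩ => main X hX h, ?_⟩
  rintro ⟨X, hX, i, hi⟩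
  refine main X hX ⟨i, fun y hy => hi y ?_⟩
  rcases hy with ⟨F, hF, hFk, rfl⟩ | ⟨x, hx, rfl⟩
  · let g : Fin k ≃ F := (F.equivFinOfCardEq hFk).symm
    refine ⟨fun j => g j, fun j => hF (g j).2, ?_⟩
    rw [g.sum_comp (fun x : F => (x : ℝ)), Finset.sum_coe_sort F fun x => x]
  · exact ⟨fun _ => x, fun _ => hx, by simp⟩
end

section
/- There is a 2-colouring of ℝ such that for every k ∈ ℕ with k ≥ 2 there does not exist a set X ⊆ ℝ with |X| = 2^{ℵ₀} such that FS_k(X) = {∑ F : F ∈ [X]^k} is monochromatic. -/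
open Cardinal

namespace SumColouring

theorem exists_uncountable_fiber {ι D : Type*} [Countable D] {Y : Set ι} (hY : ¬ Y.Countable)
    (f : ι → D) : ∃ d, ¬ {y ∈ Y | f y = d}.Countable := by
  by_contra! h
  refine hY ((Set.countable_iUnion h).mono fun y hy => ?_)
  exact Set.mem_iUnion.2 ⟨f y, hy, rfl⟩

theorem not_countable_sep {ι : Type*} {Y : Set ι} (hY : ¬ Y.Countable) {P : ι → Prop}
    (h : {y ∈ Y | ¬ P y}.Countable) : ¬ {y ∈ Y | P y}.Countable := by
  intro h'
  refine hY ((h.union h').mono fun y hy => ?_)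
  by_cases hp : P y
  · exact Or.inr ⟨hy, hp⟩
  · exact Or.inl ⟨hy, hp⟩

theorem nonempty_of_not_countable {ι : Type*} {Y : Set ι} (hY : ¬ Y.Countable) : Y.Nonempty := by
  rw [Set.nonempty_iff_ne_empty]
  rintro rfl
  exact hY Set.countable_empty

theorem countable_not_disjoint {ι B : Type*} {Y : Set ι} {s : ι → Finset B}
    (hs : ∀ b, {y ∈ Y | b ∈ s y}.Countable) (A : Finset B) :
    {y ∈ Y | ¬ Disjoint A (s y)}.Countable := by
  refine (A.countable_toSet.biUnion fun b _ => hs b).mono ?_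
  rintro y ⟨hy, hd⟩
  obtain ⟨b, hb, hb'⟩ := Finset.not_disjoint_iff.1 hd
  exact Set.mem_biUnion hb ⟨hy, hb'⟩

/-- An uncountable set can be thinned out so that a countable-to-one map into a well-order has
countable initial segments on it. -/
theorem exists_countable_initial_segments {ι B : Type*} [LinearOrder B] [WellFoundedLT B]
    {Y : Set ι} (hY : ¬ Y.Countable) (φ : ι → B) (hφ : ∀ b, {y ∈ Y | φ y = b}.Countable) :
    ∃ Y' ⊆ Y, ¬ Y'.Countable ∧ ∀ x ∈ Y', {y ∈ Y' | φ y ≤ φ x}.Countable := by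
  refine ⟨{x ∈ Y | {y ∈ Y | φ y ≤ φ x}.Countable}, Set.sep_subset _ _, fun hc => ?_,
    fun x hx => hx.2.mono (by rintro y ⟨hy, h⟩; exact ⟨hy.1, h⟩)⟩
  have hne : {x ∈ Y | ¬ {y ∈ Y | φ y ≤ φ x}.Countable}.Nonempty := by
    by_contra hne
    rw [Set.not_nonempty_iff_eq_empty] at hne
    exact not_countable_sep hY (hne ▸ Set.countable_empty) hc
  obtain ⟨z, hz, hmin⟩ := WellFounded.has_min (InvImage.wf φ wellFounded_lt) _ hne
  refine hz.2 ((hc.union (hφ (φ z))).mono ?_)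
  rintro y ⟨hy, hyz⟩
  rcases hyz.lt_or_eq with hlt | heq
  · left
    refine ⟨hy, ?_⟩
    by_contra hcy
    exact hmin y ⟨hy, hcy⟩ hlt
  · exact Or.inr ⟨hy, heq⟩

theorem exists_countable_initial_segments_finset {ι B κ : Type*} [LinearOrder B]
    [WellFoundedLT B] {Y : Set ι} (hY : ¬ Y.Countable) (φ : κ → ι → B) (T : Finset κ)
    (hφ : ∀ t ∈ T, ∀ b, {y ∈ Y | φ t y = b}.Countable) :
    ∃ Y' ⊆ Y, ¬ Y'.Countable ∧ ∀ t ∈ T, ∀ x ∈ Y', {y ∈ Y' | φ t y ≤ φ t x}.Countable := by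
  classical
  induction T using Finset.induction_on with
  | empty => exact ⟨Y, subset_rfl, hY, by simp⟩
  | insert t T _ ih =>
    obtain ⟨Y₁, hY₁, hc₁, h₁⟩ := ih fun t ht => hφ t (Finset.mem_insert_of_mem ht)
    obtain ⟨Y₂, hY₂, hc₂, h₂⟩ := exists_countable_initial_segments hc₁ (φ t) fun b =>
      (hφ t (Finset.mem_insert_self _ _) b).mono (by rintro y ⟨hy, h⟩; exact ⟨hY₁ hy, h⟩)
    refine ⟨Y₂, hY₂.trans hY₁, hc₂, fun u hu x hx => ?_⟩
    rcases Finset.mem_insert.1 hu with rfl | hu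
    · exact h₂ x hx
    · exact (h₁ u hu x (hY₂ hx)).mono (by rintro y ⟨hy, h⟩; exact ⟨hY₂ hy, h⟩)

section Colour

variable {B C : Type*}

/-- The least `N` such that `r N` separates the points of `S`. -/
noncomputable def level (r : ℕ → B → C) (S : Finset B) : ℕ :=
  sInf {N | Set.InjOn (r N) (S : Set B)}

/-- `u` and `v` are distinct members of `T` which are values of `r N` and are identified at the
previous level. -/
def IsSplit (r : ℕ → B → C) (N : ℕ) (T : Finset C) (p : C × C) : Prop :=
  p.1 ∈ T ∧ p.2 ∈ T ∧ p.1 ≠ p.2 ∧ ∃ a b, r N a = p.1 ∧ r N b = p.2 ∧ r (N - 1) a = r (N - 1) b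

open Classical in
/-- A chosen splitting pair, depending only on `N` and `T`. -/
noncomputable def split (r : ℕ → B → C) (c : C) (N : ℕ) (T : Finset C) : C × C :=
  if h : ∃ p, IsSplit r N T p then h.choose else (c, c)

theorem isSplit_split {r : ℕ → B → C} (c : C) {N : ℕ} {T : Finset C}
    (h : ∃ p, IsSplit r N T p) : IsSplit r N T (split r c N T) := by
  rw [split, dif_pos h]
  exact h.choose_spec

variable {r : ℕ → B → C} (hr : ∀ M N a b, M ≤ N → r N a = r N b → r M a = r M b)
  (hsep : ∀ a b, (∀ N, r N a = r N b) → a = b)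

include hr hsep in
theorem exists_injOn (S : Finset B) : ∃ N, Set.InjOn (r N) (S : Set B) := by
  have h : ∀ p : B × B, ∃ N, r N p.1 = r N p.2 → p.1 = p.2 := by
    intro p
    by_contra! hc
    exact (hc 0).2 (hsep _ _ fun N => (hc N).1)
  choose f hf using h
  refine ⟨(S ×ˢ S).sup f, fun a ha b hb hab => hf (a, b) (hr _ _ _ _ ?_ hab)⟩
  exact Finset.le_sup (f := f) (Finset.mk_mem_product ha hb)

include hr hsep in
theorem level_injOn (S : Finset B) : Set.InjOn (r (level r S)) (S : Set B) :=
  Nat.sInf_mem (exists_injOn hr hsep S)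

variable [DecidableEq C]

include hr in
theorem image_eq_of_le {M N : ℕ} (hMN : M ≤ N) {A A' : Finset B}
    (h : A.image (r N) = A'.image (r N)) : A.image (r M) = A'.image (r M) := by
  have key : ∀ A A' : Finset B, A.image (r N) = A'.image (r N) →
      A.image (r M) ⊆ A'.image (r M) := by
    intro A A' h c hc
    obtain ⟨a, ha, rfl⟩ := Finset.mem_image.1 hc
    obtain ⟨b, hb, hab⟩ := Finset.mem_image.1 (h ▸ Finset.mem_image_of_mem (r N) ha)
    exact Finset.mem_image.2 ⟨b, hb, hr _ _ _ _ hMN hab⟩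
  exact (key _ _ h).antisymm (key _ _ h.symm)

include hr hsep in
theorem level_eq_of_image_eq {S S' : Finset B} (hcard : S.card = S'.card)
    (h : S.image (r (level r S)) = S'.image (r (level r S))) : level r S' = level r S := by
  have key : ∀ M ≤ level r S, Set.InjOn (r M) (S : Set B) ↔ Set.InjOn (r M) (S' : Set B) := by
    intro M hM
    rw [← Finset.card_image_iff, ← Finset.card_image_iff, image_eq_of_le hr hM h, hcard]
  have hle : level r S' ≤ level r S := Nat.sInf_le ((key _ le_rfl).1 (level_injOn hr hsep S))
  exact hle.antisymm (Nat.sInf_le ((key _ hle).2 (level_injOn hr hsep S')))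

variable [LinearOrder B]

/-- The colour of a finite set: how the two points selected by its splitting pair are ordered. -/
def Colour (r : ℕ → B → C) (c : C) (S : Finset B) : Prop :=
  ∃ a ∈ S, ∃ b ∈ S, r (level r S) a = (split r c (level r S) (S.image (r (level r S)))).1 ∧
    r (level r S) b = (split r c (level r S) (S.image (r (level r S)))).2 ∧ a < b

include hr hsep in
/-- The colour of `F ∪ P ∪ Q` is determined by which of `P`, `Q` holds the first coordinate of the
splitting pair, when `P` and `Q` look alike at level `N₀` and `P` precedes `Q`. -/
theorem colour_iff (c : C) {F P Q : Finset B} {N₀ : ℕ} (hPQ : Disjoint P Q)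
    (hP : Set.InjOn (r N₀) (↑(F ∪ P) : Set B)) (hQ : Set.InjOn (r N₀) (↑(F ∪ Q) : Set B))
    (himg : P.image (r N₀) = Q.image (r N₀)) (hne : P.Nonempty)
    (hlt : ∀ a ∈ P, ∀ b ∈ Q, r N₀ a = r N₀ b → a < b) {S : Finset B} (hS : S = F ∪ P ∪ Q)
    {N : ℕ} (hN : N = level r S) {p : C × C} (hp : p = split r c N (S.image (r N))) :
    (Colour r c S ↔ p.1 ∈ P.image (r N)) ∧ (p.1 ∈ P.image (r N) ↔ p.1 ∉ Q.image (r N)) := by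
  have hPS : P ⊆ S := by rw [hS]; intro a; simp; tauto
  have hQS : Q ⊆ S := by rw [hS]; intro a; simp; tauto
  have hinj : Set.InjOn (r N) (S : Set B) := hN ▸ level_injOn hr hsep S
  have hN₀ : N₀ < N := by
    by_contra! hle
    obtain ⟨a, ha⟩ := hne
    obtain ⟨b, hb, hab⟩ := Finset.mem_image.1 (himg ▸ Finset.mem_image_of_mem (r N₀) ha)
    have := hinj (hPS ha) (hQS hb) (hr _ _ _ _ hle hab.symm)
    exact Finset.disjoint_left.1 hPQ ha (this ▸ hb)
  have hsplit : IsSplit r N (S.image (r N)) p := by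
    rw [hp]
    refine isSplit_split c ?_
    have hnot : ¬ Set.InjOn (r (N - 1)) (S : Set B) := by
      intro h
      have : level r S ≤ N - 1 := Nat.sInf_le h
      omega
    simp only [Set.InjOn, not_forall] at hnot
    obtain ⟨a, ha, b, hb, hab, hne'⟩ := hnot
    exact ⟨(r N a, r N b), Finset.mem_image_of_mem _ ha, Finset.mem_image_of_mem _ hb,
      fun h => hne' (hinj ha hb h), a, b, rfl, rfl, hab⟩
  obtain ⟨hu, hv, huv, a₀, b₀, ha₀, hb₀, hab₀⟩ := hsplit
  obtain ⟨a, ha, hau⟩ := Finset.mem_image.1 hu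
  obtain ⟨b, hb, hbv⟩ := Finset.mem_image.1 hv
  have hab : r N₀ a = r N₀ b := by
    refine hr N₀ (N - 1) a b (by omega) ?_
    rw [hr (N - 1) N a a₀ (by omega) (hau.trans ha₀.symm), hab₀,
      hr (N - 1) N b b₀ (by omega) (hbv.trans hb₀.symm)]
  have hne' : a ≠ b := by
    rintro rfl
    exact huv (hau.symm.trans hbv)
  have hcol : Colour r c S ↔ a < b := by
    rw [Colour, ← hN, ← hp]
    constructor
    · rintro ⟨a', ha', b', hb', h1, h2, h3⟩
      rwa [hinj ha ha' (hau.trans h1.symm), hinj hb hb' (hbv.trans h2.symm)]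
    · exact fun h => ⟨a, ha, b, hb, hau, hbv, h⟩
  have himgP : p.1 ∈ P.image (r N) ↔ a ∈ P := by
    refine ⟨fun h => ?_, fun h => hau ▸ Finset.mem_image_of_mem _ h⟩
    obtain ⟨a', ha', h'⟩ := Finset.mem_image.1 h
    rwa [hinj ha (hPS ha') (hau.trans h'.symm)]
  have himgQ : p.1 ∈ Q.image (r N) ↔ a ∈ Q := by
    refine ⟨fun h => ?_, fun h => hau ▸ Finset.mem_image_of_mem _ h⟩
    obtain ⟨a', ha', h'⟩ := Finset.mem_image.1 h
    rwa [hinj ha (hQS ha') (hau.trans h'.symm)]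
  have hnP : ¬ (a ∈ F ∪ P ∧ b ∈ F ∪ P) := fun h => hne' (hP h.1 h.2 hab)
  have hnQ : ¬ (a ∈ F ∪ Q ∧ b ∈ F ∪ Q) := fun h => hne' (hQ h.1 h.2 hab)
  rw [hcol, himgP, himgQ]
  have hd : ∀ x ∈ P, x ∉ Q := fun x hx => Finset.disjoint_left.1 hPQ hx
  rw [hS] at ha hb
  simp only [Finset.mem_union] at ha hb hnP hnQ
  have hcases : (a ∈ P ∧ b ∈ Q) ∨ (a ∈ Q ∧ b ∈ P) := by
    clear * - ha hb hnP hnQ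
    grind
  rcases hcases with ⟨h1, h2⟩ | ⟨h1, h2⟩
  · have := hlt a h1 b h2 hab
    have := hd a h1
    simp [*]
  · have hba := (hlt b h2 a h1 hab.symm).not_gt
    have : a ∉ P := fun h => hd a h h1
    simp only [hba, this, h1, not_true_eq_false, and_self]

include hr hsep in
/-- Every uncountable point-countable family of finite sets yields both colours. -/
theorem exists_colour_ne [WellFoundedLT B] [Countable C] (c : C) {ι : Type*} {Y : Set ι}
    (hY : ¬ Y.Countable) (s : ι → Finset B) (hne : ∀ y ∈ Y, (s y).Nonempty)
    (hs : ∀ b, {y ∈ Y | b ∈ s y}.Countable) (F : Finset B) :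
    ∃ x ∈ Y, ∃ x' ∈ Y, ∃ y ∈ Y, Disjoint F (s x) ∧ Disjoint F (s x') ∧ Disjoint F (s y) ∧
      Disjoint (s x) (s x') ∧ Disjoint (s x') (s y) ∧
      (Colour r c (F ∪ s x ∪ s x') ↔ ¬ Colour r c (F ∪ s x' ∪ s y)) := by
  have hY₁ := not_countable_sep hY (countable_not_disjoint hs F)
  choose N hN using fun y => exists_injOn hr hsep (F ∪ s y)
  obtain ⟨⟨N₀, T⟩, hY₂⟩ :=
    exists_uncountable_fiber hY₁ fun y => (N y, (s y).image (r (N y)))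
  set Y₂ : Set ι := {y ∈ {y ∈ Y | Disjoint F (s y)} | (N y, (s y).image (r (N y))) = (N₀, T)}
  have hsub : ∀ y ∈ Y₂, y ∈ Y := fun y hy => hy.1.1
  have hdisj : ∀ y ∈ Y₂, Disjoint F (s y) := fun y hy => hy.1.2
  have hinj : ∀ y ∈ Y₂, Set.InjOn (r N₀) (↑(F ∪ s y) : Set B) := by
    intro y hy
    have := hN y
    rwa [(Prod.mk.inj hy.2).1] at this
  have himg : ∀ y ∈ Y₂, (s y).image (r N₀) = T := by
    intro y hy
    have := (Prod.mk.inj hy.2).2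
    rwa [(Prod.mk.inj hy.2).1] at this
  obtain ⟨y₀, hy₀⟩ := nonempty_of_not_countable hY₂
  obtain ⟨b₀, -⟩ := hne y₀ (hsub y₀ hy₀)
  have hφ : ∀ t y, ∃ b, t ∈ T → y ∈ Y₂ → b ∈ s y ∧ r N₀ b = t := by
    intro t y
    by_cases h : t ∈ T ∧ y ∈ Y₂
    · obtain ⟨b, hb⟩ := Finset.mem_image.1 ((himg y h.2).symm ▸ h.1)
      exact ⟨b, fun _ _ => hb⟩
    · exact ⟨b₀, fun h1 h2 => (h ⟨h1, h2⟩).elim⟩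
  choose φ hφ using hφ
  obtain ⟨Y₃, hY₃₂, hY₃, hseg⟩ := exists_countable_initial_segments_finset hY₂ φ T
    fun t ht b => (hs b).mono (by
      rintro y ⟨hy, rfl⟩
      exact ⟨hsub y hy, (hφ t y ht hy).1⟩)
  have hφ_eq : ∀ y ∈ Y₃, ∀ a ∈ s y, φ (r N₀ a) y = a := by
    intro y hy a ha
    have hy₂ := hY₃₂ hy
    obtain ⟨h1, h2⟩ := hφ (r N₀ a) y (himg y hy₂ ▸ Finset.mem_image_of_mem _ ha) hy₂
    exact hinj y hy₂ (Finset.mem_union_right _ h1) (Finset.mem_union_right _ ha) h2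
  have hnext : ∀ x ∈ Y₃, ∀ Z ⊆ Y₃, ¬ Z.Countable → ∃ y ∈ Z,
      Disjoint (s x) (s y) ∧ ∀ a ∈ s x, ∀ b ∈ s y, r N₀ a = r N₀ b → a < b := by
    intro x hx Z hZ hZc
    have hc : ({y ∈ Y | ¬ Disjoint (s x) (s y)} ∪
        ⋃ t ∈ (T : Set C), {y ∈ Y₃ | φ t y ≤ φ t x}).Countable :=
      (countable_not_disjoint hs (s x)).union
        (T.countable_toSet.biUnion fun t ht => hseg t ht x hx)
    obtain ⟨y, hyZ, hy⟩ := Set.not_subset.1 fun h => hZc (hc.mono h)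
    have hyY := hZ hyZ
    refine ⟨y, hyZ, ?_, fun a ha b hb hab => ?_⟩
    · by_contra hd
      exact hy (Or.inl ⟨hsub y (hY₃₂ hyY), hd⟩)
    · by_contra! hle
      refine hy (Or.inr (Set.mem_biUnion (x := r N₀ a) ?_ ⟨hyY, ?_⟩))
      · exact himg x (hY₃₂ hx) ▸ Finset.mem_image_of_mem _ ha
      · rw [hφ_eq x hx a ha, hab, hφ_eq y hyY b hb]
        exact hle
  have hnext' : ∀ x, ∃ y, x ∈ Y₃ → y ∈ Y₃ ∧
      Disjoint (s x) (s y) ∧ ∀ a ∈ s x, ∀ b ∈ s y, r N₀ a = r N₀ b → a < b := by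
    intro x
    by_cases hx : x ∈ Y₃
    · obtain ⟨y, hy⟩ := hnext x hx Y₃ subset_rfl hY₃
      exact ⟨y, fun _ => hy⟩
    · exact ⟨x, fun h => (hx h).elim⟩
  choose f hf using hnext'
  let L : ι → ℕ := fun x => level r (F ∪ s x ∪ s (f x))
  obtain ⟨⟨N₁, U, V⟩, hY₄⟩ := exists_uncountable_fiber hY₃
    fun x => (L x, (s x).image (r (L x)), (s (f x)).image (r (L x)))
  obtain ⟨x, hx, hxe⟩ := nonempty_of_not_countable hY₄
  obtain ⟨hx', hd, hlt⟩ := hf x hx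
  obtain ⟨y, ⟨hy, hye⟩, hd', hlt'⟩ := hnext (f x) hx' _ (Set.sep_subset _ _) hY₄
  simp only [Prod.mk.injEq] at hxe hye
  have hLy : L y = L x := hye.1.trans hxe.1.symm
  have himgxy : (s y).image (r (L x)) = (s x).image (r (L x)) := by
    rw [hxe.2.1, ← hLy, hye.2.1]
  have hx₂ := hY₃₂ hx
  have hx₂' := hY₃₂ hx'
  have hy₂ := hY₃₂ hy
  have hcard : (s x).card = (s y).card := by
    have h : ∀ z ∈ Y₂, (s z).card = T.card := by
      intro z hz
      rw [← himg z hz, Finset.card_image_of_injOn]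
      exact (hinj z hz).mono (by simp)
    rw [h x hx₂, h y hy₂]
  have hdF : ∀ z ∈ Y₂, ∀ w ∈ Y₂, Disjoint (s z) (s w) →
      (F ∪ s z ∪ s w).card = F.card + (s z).card + (s w).card := by
    intro z hz w hw hzw
    rw [Finset.card_union_of_disjoint (Finset.disjoint_union_left.2 ⟨hdisj w hw, hzw⟩),
      Finset.card_union_of_disjoint (hdisj z hz)]
  have himgS : (F ∪ s x ∪ s (f x)).image (r (L x)) = (F ∪ s (f x) ∪ s y).image (r (L x)) := by
    rw [Finset.image_union, Finset.image_union, Finset.image_union, Finset.image_union, himgxy,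
      Finset.union_right_comm]
  have hlev : level r (F ∪ s (f x) ∪ s y) = L x := by
    refine level_eq_of_image_eq hr hsep ?_ himgS
    rw [hdF x hx₂ _ hx₂' hd, hdF _ hx₂' y hy₂ hd', hcard]
    omega
  have h1 := colour_iff hr hsep c hd (hinj x hx₂) (hinj _ hx₂')
    ((himg x hx₂).trans (himg _ hx₂').symm) (hne x (hsub x hx₂)) hlt rfl (N := L x) rfl rfl
  have h2 := colour_iff hr hsep c hd' (hinj _ hx₂') (hinj y hy₂)
    ((himg _ hx₂').trans (himg y hy₂).symm) (hne _ (hsub _ hx₂')) hlt' rfl hlev.symm rfl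
  rw [← himgS] at h2
  refine ⟨x, hsub x hx₂, f x, hsub _ hx₂', y, hsub y hy₂, hdisj x hx₂, hdisj _ hx₂', hdisj y hy₂,
    hd, hd', ?_⟩
  rw [h1.1, h2.1, h1.2]

end Colour

/-- After a translation and thinning out, an uncountable set of finitely supported functions has
nonempty supports in which every point occurs countably often. -/
theorem exists_translate_pointCountable {B : Type*} {X : Set (B →₀ ℚ)} (hX : ¬ X.Countable) :
    ∃ w : B →₀ ℚ, ∃ Y ⊆ X, ¬ Y.Countable ∧ (∀ y ∈ Y, (y - w).support.Nonempty) ∧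
      ∀ b, {y ∈ Y | b ∈ (y - w).support}.Countable := by
  classical
  have hex : ∃ n, ∃ w : B →₀ ℚ, ¬ {x ∈ X | (x - w).support.card = n}.Countable := by
    obtain ⟨n, hn⟩ := exists_uncountable_fiber hX fun x => (x - 0).support.card
    exact ⟨n, 0, hn⟩
  obtain ⟨w, hw⟩ := Nat.find_spec hex
  refine ⟨w, {x ∈ {x ∈ X | (x - w).support.card = Nat.find hex} | (x - w).support.Nonempty},
    fun y hy => hy.1.1, not_countable_sep hw ?_, fun y hy => hy.2, fun b => ?_⟩
  · refine (Set.countable_singleton w).mono ?_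
    rintro y ⟨-, hy⟩
    rw [Finset.not_nonempty_iff_eq_empty, Finsupp.support_eq_empty, sub_eq_zero] at hy
    exact hy
  · by_contra hc
    obtain ⟨q, hq⟩ := exists_uncountable_fiber hc fun y => (y - w) b
    obtain ⟨z, hz⟩ := nonempty_of_not_countable hq
    have key : ∀ y : B →₀ ℚ, (y - w) b = q →
        (y - (w + Finsupp.single b q)).support = (y - w).support.erase b := by
      intro y hy
      rw [← Finsupp.support_erase]
      congr 1
      ext a
      by_cases hab : a = b
      · subst hab
        simp at hy ⊢
        linarith
      · simp [Finsupp.erase_ne hab, Ne.symm hab]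
    refine Nat.find_min hex (m := Nat.find hex - 1) ?_ ⟨w + Finsupp.single b q, ?_⟩
    · have : 0 < Nat.find hex := hz.1.1.1.2 ▸ Finset.card_pos.2 hz.1.1.2
      omega
    · refine fun h => hq (h.mono ?_)
      rintro y ⟨⟨⟨⟨hyX, hyc⟩, -⟩, hyb⟩, hyq⟩
      refine ⟨hyX, ?_⟩
      rw [key y hyq, Finset.card_erase_of_mem hyb, hyc]

theorem support_add_add {B : Type*} [DecidableEq B] {w x y : B →₀ ℚ}
    (hwx : Disjoint w.support x.support) (hwy : Disjoint w.support y.support)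
    (hxy : Disjoint x.support y.support) :
    (w + x + y).support = w.support ∪ x.support ∪ y.support := by
  have h := Finsupp.support_add_eq hwx
  rw [Finsupp.support_add_eq, h]
  rw [h]
  exact Finset.disjoint_union_left.2 ⟨hwy, hxy⟩

/-- Finitely supported functions on a set of reals admit a 2-colouring in which no translate of the
pairwise sums of an uncountable set is monochromatic. -/
theorem exists_colouring_finsupp {B : Type*} (e : B → ℕ → Bool) (he : Function.Injective e) :
    ∃ ψ : (B →₀ ℚ) → Prop, ∀ X : Set (B →₀ ℚ), ¬ X.Countable → ∀ v : B →₀ ℚ,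
      ∃ x ∈ X, ∃ y ∈ X, ∃ x' ∈ X, ∃ y' ∈ X, x ≠ y ∧ x' ≠ y' ∧
        (ψ (v + x + y) ↔ ¬ ψ (v + x' + y')) := by
  classical
  let _ : LinearOrder B := linearOrderOfSTO WellOrderingRel
  have _ : WellFoundedLT B := ⟨(inferInstance : IsWellFounded B WellOrderingRel).wf⟩
  let r : ℕ → B → List Bool := fun N b => (List.range N).map (e b)
  have hr : ∀ M N a b, M ≤ N → r N a = r N b → r M a = r M b := by
    intro M N a b hMN h
    simp only [r, List.map_inj_left, List.mem_range] at h ⊢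
    exact fun i hi => h i (hi.trans_le hMN)
  have hsep : ∀ a b, (∀ N, r N a = r N b) → a = b := by
    intro a b h
    refine he (funext fun n => ?_)
    have := h (n + 1)
    simp only [r, List.map_inj_left, List.mem_range] at this
    exact this n n.lt_succ_self
  refine ⟨fun v => Colour r [] v.support, fun X hX v => ?_⟩
  obtain ⟨w, Y, hYX, hY, hne, hpc⟩ := exists_translate_pointCountable hX
  obtain ⟨x, hx, x', hx', y, hy, h1, h2, h3, h4, h5, h⟩ :=
    exists_colour_ne hr hsep [] hY (fun y => (y - w).support) hne hpc (v + w + w).support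
  have hsum : ∀ a b : B →₀ ℚ, v + a + b = (v + w + w) + (a - w) + (b - w) := by
    intro a b
    abel
  have hdne : ∀ a ∈ Y, ∀ b ∈ Y, Disjoint (a - w).support (b - w).support → a ≠ b := by
    rintro a ha b - hd rfl
    rw [disjoint_self] at hd
    exact (hne a ha).ne_empty hd
  refine ⟨x, hYX hx, x', hYX hx', x', hYX hx', y, hYX hy, hdne x hx x' hx' h4,
    hdne x' hx' y hy h5, ?_⟩
  beta_reduce
  rw [hsum x x', hsum x' y, support_add_add h1 h2 h4, support_add_add h2 h3 h5]
  exact h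

theorem exists_injective_real : ∃ e : ℝ → ℕ → Bool, Function.Injective e := by
  have h : #ℝ = #(ℕ → Bool) := by simp [Cardinal.mk_real]
  obtain ⟨e⟩ := Cardinal.eq.1 h
  exact ⟨e, e.injective⟩

/-- The reals admit a 2-colouring in which no translate of the pairwise sums of an uncountable set
is monochromatic. -/
theorem exists_colouring_real :
    ∃ ψ : ℝ → Prop, ∀ X : Set ℝ, ¬ X.Countable → ∀ v : ℝ,
      ∃ x ∈ X, ∃ y ∈ X, ∃ x' ∈ X, ∃ y' ∈ X, x ≠ y ∧ x' ≠ y' ∧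
        (ψ (v + x + y) ↔ ¬ ψ (v + x' + y')) := by
  obtain ⟨e, he⟩ := exists_injective_real
  let b := Module.Basis.ofVectorSpace ℚ ℝ
  obtain ⟨ψ, hψ⟩ := exists_colouring_finsupp
    (fun i : Module.Basis.ofVectorSpaceIndex ℚ ℝ => e i) (he.comp Subtype.val_injective)
  refine ⟨fun x => ψ (b.repr x), fun X hX v => ?_⟩
  have hX' : ¬ (b.repr '' X).Countable := fun h =>
    hX (Set.countable_of_injective_of_countable_image b.repr.injective.injOn h)
  obtain ⟨_, ⟨x, hx, rfl⟩, _, ⟨y, hy, rfl⟩, _, ⟨x', hx', rfl⟩, _, ⟨y', hy', rfl⟩, h, h', hc⟩ :=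
    hψ _ hX' (b.repr v)
  refine ⟨x, hx, y, hy, x', hx', y', hy', fun h0 => h (h0 ▸ rfl), fun h0 => h' (h0 ▸ rfl), ?_⟩
  simpa only [map_add] using hc

end SumColouring

open SumColouring in
theorem stmt_11 :
    ∃ ψ : ℝ → Fin 2, ∀ k : ℕ, 2 ≤ k →
      ¬ ∃ X : Set ℝ, #X = Cardinal.continuum ∧ ∃ i, ∀ y ∈ FS k X, ψ y = i := by
  classical
  obtain ⟨ψ, hψ⟩ := exists_colouring_real
  refine ⟨fun x => if ψ x then 1 else 0, ?_⟩
  rintro k hk ⟨X, hX, i, hi⟩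
  have hXc : ¬ X.Countable := by
    rw [← Cardinal.le_aleph0_iff_set_countable, hX, not_le]
    exact Cardinal.aleph0_lt_continuum
  have hXi : X.Infinite := fun h => hXc h.countable
  obtain ⟨Z, hZX, hZ⟩ := hXi.exists_subset_card_eq (k - 2)
  have hXZ : ¬ (X \ Z).Countable := fun h =>
    hXc ((h.union Z.countable_toSet).mono (by simp))
  obtain ⟨x, hx, y, hy, x', hx', y', hy', hxy, hxy', h⟩ := hψ _ hXZ (∑ z ∈ Z, z)
  have hmem : ∀ a ∈ X \ (Z : Set ℝ), ∀ b ∈ X \ (Z : Set ℝ), a ≠ b →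
      ∑ z ∈ Z, z + a + b ∈ FS k X := by
    rintro a ⟨haX, haZ⟩ b ⟨hbX, hbZ⟩ hab
    rw [Finset.mem_coe] at haZ hbZ
    have ha : a ∉ insert b Z := by simp [hab, haZ]
    refine ⟨insert a (insert b Z), ?_, ?_, ?_⟩
    · simp [Set.insert_subset_iff, haX, hbX, hZX]
    · rw [Finset.card_insert_of_notMem ha, Finset.card_insert_of_notMem hbZ, hZ]
      omega
    · rw [Finset.sum_insert ha, Finset.sum_insert hbZ]
      ring
  have h1 := hi _ (hmem x hx y hy hxy)
  have h2 := hi _ (hmem x' hx' y' hy' hxy')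
  have h3 := h1.trans h2.symm
  by_cases hp : ψ (∑ z ∈ Z, z + x + y)
  · simp [hp, h.1 hp] at h3
  · have hq : ψ (∑ z ∈ Z, z + x' + y') := by tauto
    simp [hp, hq] at h3
end
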